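/- Let k be a nonarchimedean local field and n ≥ 3. Fix s ≥ 0 and ν_1, …, ν_s ∈ k with |ν_1| > ⋯ > |ν_s| > 2, and define A ∈ GL_{n−3}(k) as follows: if n = 3, A is the empty 0×0 block; if n ∈ {4, 5}, A = I_{n−3}; if n = 2s+4 with s ≥ 1, A = diag(ν_1, 1+ν_1, …, ν_s, 1+ν_s, ∏_{i=1}^s (ν_i + ν_i²)⁻¹); if n = 2s+5 with s ≥ 1, A = diag(ν_1, 1+ν_1, …, ν_s, 1+ν_s, ∏_{i=1}^s (ν_i + ν_i²)⁻¹, 1). Let ν ∈ k with |ν| ≥ 10n·(1 + max(‖A‖, ‖A⁻¹‖)) (where ‖A‖ = ‖A⁻¹‖ = 0 if n = 3), set C := diag(ν, 1+ν, (ν+ν²)⁻¹, A) ∈ GL_n(k), and fix ε with 0 < ε ≤ min{(1/2)·min_{i≠j}|C_{ii} − C_{jj}|, |ν|⁻³}. Set y := [e_1 + ν·e_2 − (1+ν)·e_3] ∈ ℙ(k^n) and V := {u ∈ k^n : u_1 + u_2 + u_3 = 0}. Suppose C_ε = h·diag(λ_1, λ_2, λ_3, A')·h⁻¹, where h ∈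 GL_n(k) satisfies ‖h − I‖ < ε and ‖h⁻¹ − I‖ < ε, λ_1, λ_2, λ_3 ∈ k satisfy |λ_1 − ν| < ε, |λ_2 − (1+ν)| < ε, |λ_3 − (ν+ν²)⁻¹| < ε, and A' ∈ GL_{n−3}(k) is diagonal with |A_{jj} − A'_{jj}| < ε for all j. Then for every integer p ≠ 0 and every nonzero u ∈ k^n with [u] ∈ B_ε(y): dist([C_ε^p u], ℙ(V)) ≥ 1/6 and ‖C_ε^p u‖ ≥ 2^{|p|}·‖u‖. -/

import Mathlib

noncomputable section

/-- Sup norm on `Fin n → k`. -/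
def supN {k : Type*} [NormedField k] {n : ℕ} (v : Fin n → k) : ℝ :=
  ⨆ i, ‖v i‖

/-- Projective distance between (the lines of) two nonzero vectors, with respect to the sup
norm. -/
def dPg {k : Type*} [NormedField k] {n : ℕ} (u v : Fin n → k) : ℝ :=
  sInf {r : ℝ | ∃ a b ζ : k, supN (a • u) = 1 ∧ supN (b • v) = 1 ∧ ‖ζ‖ = 1 ∧
    r = supN (ζ • a • u - b • v)}

/-- Distance from a projective point to the projectivization of a subspace. -/
def distPSg {k : Type*} [NormedField k] {n : ℕ} (u : Fin n → k)
    (W : Submodule k (Fin n → k)) : ℝ :=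
  sInf {r : ℝ | ∃ w : Fin n → k, w ∈ W ∧ w ≠ 0 ∧ r = dPg u w}

/-- The sup-of-entries norm of a square matrix over a normed field. -/
def matSup {k : Type*} [NormedField k] {n : ℕ} (A : Matrix (Fin n) (Fin n) k) : ℝ :=
  ⨆ i, ⨆ j, ‖A i j‖

/-- The diagonal of the block `A` from the construction of Theorem 1 (nonarchimedean case):
empty for `n = 3`, the identity for `n ∈ {4,5}`, and built from `ν₁, …, ν_s` for
`n = 2s+4` or `n = 2s+5`. -/
def Adiag {k : Type*} [Field k] (n s : ℕ) (ν : Fin s → k) : Fin (n - 3) → k := fun j =>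
  if n = 4 ∨ n = 5 then 1
  else if h2 : (j : ℕ) < 2 * s then
    (if (j : ℕ) % 2 = 0 then ν ⟨(j : ℕ) / 2, by omega⟩ else 1 + ν ⟨(j : ℕ) / 2, by omega⟩)
  else if (j : ℕ) = 2 * s then (∏ i, (ν i + ν i ^ 2))⁻¹
  else 1

/-- The diagonal of `C = diag(ν, 1+ν, (ν+ν²)⁻¹, A)`. -/
def Cdiag {k : Type*} [Field k] (n s : ℕ) (ν₀ : k) (ν : Fin s → k) : Fin n → k := fun i =>
  if (i : ℕ) = 0 then ν₀
  else if (i : ℕ) = 1 then 1 + ν₀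
  else if (i : ℕ) = 2 then (ν₀ + ν₀ ^ 2)⁻¹
  else if _hi : 3 ≤ (i : ℕ) then Adiag n s ν ⟨(i : ℕ) - 3, by have := i.2; omega⟩ else 0

/-- The diagonal of `diag(λ₁, λ₂, λ₃, A')`. -/
def Ddiag {k : Type*} [Field k] (n : ℕ) (l₁ l₂ l₃ : k) (A' : Fin (n - 3) → k) :
    Fin n → k := fun i =>
  if (i : ℕ) = 0 then l₁
  else if (i : ℕ) = 1 then l₂
  else if (i : ℕ) = 2 then l₃
  else if _hi : 3 ≤ (i : ℕ) then A' ⟨(i : ℕ) - 3, by have := i.2; omega⟩ else 0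

section SupNorm

variable {k : Type*} [NormedField k] {n : ℕ}

lemma norm_le_supN (v : Fin n → k) (i : Fin n) : ‖v i‖ ≤ supN v :=
  le_ciSup (f := fun i => ‖v i‖) (Set.finite_range _).bddAbove i

lemma supN_eq_norm_of_forall_le {v : Fin n → k} (i : Fin n) (hi : ∀ j, ‖v j‖ ≤ ‖v i‖) :
    supN v = ‖v i‖ :=
  have : Nonempty (Fin n) := ⟨i⟩
  le_antisymm (ciSup_le hi) (norm_le_supN v i)

lemma supN_nonneg (v : Fin n → k) : 0 ≤ supN v :=
  Real.iSup_nonneg fun _ => norm_nonneg _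

lemma supN_pos {v : Fin n → k} (hv : v ≠ 0) : 0 < supN v := by
  obtain ⟨i, hi⟩ := Function.ne_iff.mp hv
  exact (norm_pos_iff.mpr hi).trans_le (norm_le_supN v i)

lemma supN_smul (a : k) (v : Fin n → k) : supN (a • v) = ‖a‖ * supN v := by
  simp only [supN, Pi.smul_apply, smul_eq_mul, norm_mul]
  exact (Real.mul_iSup_of_nonneg (norm_nonneg a) _).symm

lemma exists_supN_smul_eq_one {v : Fin n → k} (hv : v ≠ 0) : ∃ a : k, supN (a • v) = 1 := by
  obtain ⟨i, hi⟩ := Function.ne_iff.mp hv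
  have : Nonempty (Fin n) := ⟨i⟩
  obtain ⟨m, hm⟩ := exists_eq_ciSup_of_finite (f := fun i => ‖v i‖)
  have hpos := supN_pos hv
  refine ⟨(v m)⁻¹, ?_⟩
  rw [supN_smul, norm_inv, show ‖v m‖ = supN v from hm, inv_mul_cancel₀ hpos.ne']

lemma norm_apply_le_matSup (A : Matrix (Fin n) (Fin n) k) (i j : Fin n) :
    ‖A i j‖ ≤ matSup A :=
  (le_ciSup (f := fun j => ‖A i j‖) (Set.finite_range _).bddAbove j).trans
    (le_ciSup (f := fun i => ⨆ j, ‖A i j‖) (Set.finite_range _).bddAbove i)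

variable [IsUltrametricDist k]

lemma norm_lt_of_norm_sub_lt {x y : k} {M : ℝ} (h : ‖x - y‖ < M) (hy : ‖y‖ < M) : ‖x‖ < M := by
  simpa using (IsUltrametricDist.norm_add_le_max (x - y) y).trans_lt (max_lt h hy)

lemma norm_eq_of_norm_sub_lt {x y : k} (h : ‖x - y‖ < ‖y‖) : ‖x‖ = ‖y‖ := by
  have h1 := IsUltrametricDist.norm_add_eq_max_of_norm_ne_norm h.ne
  rwa [sub_add_cancel, max_eq_right h.le] at h1

/-- A matrix close to the identity moves every coordinate by less than the norm of the vector. -/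
lemma norm_mulVec_sub_lt {g : Matrix (Fin n) (Fin n) k} (hg : matSup (g - 1) < 1)
    {v : Fin n → k} {M : ℝ} (hM : 0 < M) (hv : ∀ j, ‖v j‖ ≤ M) (i : Fin n) :
    ‖g.mulVec v i - v i‖ < M := by
  have hsub : g.mulVec v i - v i = ∑ j, (g - 1) i j * v j := by
    have h1 : (g - 1).mulVec v i = g.mulVec v i - v i := by
      rw [Matrix.sub_mulVec, Matrix.one_mulVec, Pi.sub_apply]
    rw [← h1]
    rfl
  have hnn : 0 ≤ matSup (g - 1) :=
    (norm_nonneg ((g - 1) i i)).trans (norm_apply_le_matSup _ i i)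
  rw [hsub]
  refine (IsUltrametricDist.norm_sum_le_of_forall_le_of_nonneg (C := matSup (g - 1) * M)
    (by positivity) fun j _ => ?_).trans_lt (by nlinarith)
  rw [norm_mul]
  exact mul_le_mul (norm_apply_le_matSup _ i j) (hv j) (norm_nonneg _) hnn

lemma one_le_distPSg {W : Submodule k (Fin n → k)} {a b c : Fin n}
    (hW : ∀ w ∈ W, w a + w b + w c = 0) (hW0 : ∃ w ∈ W, w ≠ 0)
    {z : Fin n → k} (hz0 : z ≠ 0) (hz : ‖z a + z b + z c‖ = supN z) :
    1 ≤ distPSg z W := by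
  obtain ⟨w₀, hw₀, hw₀'⟩ := hW0
  refine le_csInf ⟨_, w₀, hw₀, hw₀', rfl⟩ ?_
  rintro _ ⟨w, hw, hw', rfl⟩
  obtain ⟨α, hα⟩ := exists_supN_smul_eq_one hz0
  obtain ⟨β, hβ⟩ := exists_supN_smul_eq_one hw'
  refine le_csInf ⟨_, α, β, 1, hα, hβ, norm_one, rfl⟩ ?_
  rintro _ ⟨α, β, ζ, hα, -, hζ, rfl⟩
  set x := ζ • α • z - β • w with hx
  have hsum : x a + x b + x c = ζ * α * (z a + z b + z c) := by
    simp only [hx, Pi.sub_apply, Pi.smul_apply, smul_eq_mul]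
    linear_combination (-β) * hW w hw
  have hone : ‖x a + x b + x c‖ = 1 := by
    rw [hsum, norm_mul, norm_mul, hζ, hz, one_mul, ← supN_smul, hα]
  rw [← hone]
  exact (IsUltrametricDist.norm_add_le_max _ _).trans (max_le
    ((IsUltrametricDist.norm_add_le_max _ _).trans (max_le (norm_le_supN x a) (norm_le_supN x b)))
    (norm_le_supN x c))

/-- If the coordinate `m ∈ {b, c}` strictly dominates all others, then the vector is at
distance at least `1` from the plane on which the coordinates `a, b, c` sum to zero. -/
lemma one_le_distPSg_of_dominant {W : Submodule k (Fin n → k)} {a b c : Fin n}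
    (hab : a ≠ b) (hac : a ≠ c) (hbc : b ≠ c)
    (hW : ∀ w ∈ W, w a + w b + w c = 0) (hW0 : ∃ w ∈ W, w ≠ 0)
    {z : Fin n → k} {m : Fin n} (hm : m = b ∨ m = c) (hpos : 0 < ‖z m‖)
    (hz : ∀ j, j ≠ m → ‖z j‖ < ‖z m‖) :
    1 ≤ distPSg z W ∧ supN z = ‖z m‖ := by
  have hsup : supN z = ‖z m‖ := supN_eq_norm_of_forall_le m fun j => by
    rcases eq_or_ne j m with rfl | hj
    · exact le_rfl
    · exact (hz j hj).le
  refine ⟨one_le_distPSg hW hW0 (fun h0 => by simp [h0] at hpos) ?_, hsup⟩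
  rw [hsup]
  apply norm_eq_of_norm_sub_lt
  rcases hm with rfl | rfl
  · rw [show z a + z m + z c - z m = z a + z c by ring]
    exact (IsUltrametricDist.norm_add_le_max _ _).trans_lt (max_lt (hz a hab) (hz c hbc.symm))
  · rw [show z a + z b + z m - z m = z a + z b by ring]
    exact (IsUltrametricDist.norm_add_le_max _ _).trans_lt (max_lt (hz a hac) (hz b hbc))

end SupNorm

lemma coe_zpow_eq_diagonal {k : Type*} [Field k] {n : ℕ} (D : (Matrix (Fin n) (Fin n) k)ˣ)
    {d : Fin n → k} (hd : ∀ i, d i ≠ 0)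
    (hD : (D : Matrix (Fin n) (Fin n) k) = Matrix.diagonal d) (p : ℤ) :
    ((D ^ p : _) : Matrix (Fin n) (Fin n) k) = Matrix.diagonal fun i => d i ^ p := by
  have hpow : ∀ q : ℕ, ((D ^ q : _) : Matrix (Fin n) (Fin n) k) =
      Matrix.diagonal fun i => d i ^ q := fun q => by
    rw [Units.val_pow_eq_pow_val, hD, Matrix.diagonal_pow]
    rfl
  obtain ⟨q, rfl | rfl⟩ := p.eq_nat_or_neg
  · simpa using hpow q
  · rw [zpow_neg, zpow_natCast]
    apply Units.inv_eq_of_mul_eq_one_right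
    rw [hpow, Matrix.diagonal_mul_diagonal, ← Matrix.diagonal_one]
    congr 1
    ext i
    simp [hd i]

lemma Adiag_ne_zero {k : Type*} [NormedField k] {n s : ℕ} {ν : Fin s → k}
    (hν2 : ∀ i : Fin s, 2 < ‖ν i‖) (j : Fin (n - 3)) : Adiag n s ν j ≠ 0 := by
  have h0 : ∀ i, ν i ≠ 0 := fun i h => by
    have := hν2 i
    rw [h, norm_zero] at this
    linarith
  have h1 : ∀ i, 1 + ν i ≠ 0 := fun i h => by
    have := hν2 i
    rw [← neg_eq_of_add_eq_zero_right h, norm_neg, norm_one] at this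
    linarith
  unfold Adiag
  split_ifs
  · exact one_ne_zero
  · exact h0 _
  · exact h1 _
  · refine inv_ne_zero (Finset.prod_ne_zero_iff.mpr fun i _ => ?_)
    rw [show ν i + ν i ^ 2 = ν i * (1 + ν i) by ring]
    exact mul_ne_zero (h0 i) (h1 i)
  · exact one_ne_zero

/-- Coordinates of a vector whose line is at distance less than `1` from a line spanned by `y`,
where `y` has its largest coordinates exactly at `b` and `c`. -/
lemma norm_eq_supN_of_dPg_lt_one {k : Type*} [NormedField k] [IsUltrametricDist k] {n : ℕ}
    {y u : Fin n → k} {b c : Fin n} (hy0 : y ≠ 0) (hbc : ‖y b‖ = ‖y c‖)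
    (hy : ∀ j, j ≠ b → j ≠ c → ‖y j‖ < ‖y b‖) (hu : u ≠ 0) (hd : dPg y u < 1) :
    ‖u b‖ = supN u ∧ ‖u c‖ = supN u ∧ ∀ j, j ≠ b → j ≠ c → ‖u j‖ < supN u := by
  obtain ⟨α, hα⟩ := exists_supN_smul_eq_one hy0
  obtain ⟨β, hβ⟩ := exists_supN_smul_eq_one hu
  obtain ⟨_, ⟨α, β, ζ, hα, hβ, hζ, rfl⟩, hlt⟩ :=
    exists_lt_of_csInf_lt (by exact ⟨_, α, β, 1, hα, hβ, norm_one, rfl⟩) hd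
  have hsup : supN y = ‖y b‖ := supN_eq_norm_of_forall_le b fun j => by
    by_cases h1 : j = b
    · rw [h1]
    by_cases h2 : j = c
    · rw [h2, hbc]
    exact (hy j h1 h2).le
  rw [supN_smul] at hα hβ
  have hβ0 : 0 < ‖β‖ := (norm_nonneg β).lt_of_ne fun h => by simp [← h] at hβ
  have hα0 : 0 < ‖α‖ := (norm_nonneg α).lt_of_ne fun h => by simp [← h] at hα
  have hx : ∀ j, ‖β * u j - ζ * (α * y j)‖ < 1 := fun j => by
    rw [norm_sub_rev]
    exact (norm_le_supN (ζ • α • y - β • u) j).trans_lt hlt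
  have hn : ∀ j, ‖ζ * (α * y j)‖ = ‖α‖ * ‖y j‖ := fun j => by rw [norm_mul, norm_mul, hζ, one_mul]
  have heq : ∀ j, ‖y j‖ = supN y → ‖u j‖ = supN u := fun j hj => by
    have h1 : ‖ζ * (α * y j)‖ = 1 := by rw [hn, hj, hα]
    have h2 := norm_eq_of_norm_sub_lt (h1.symm ▸ hx j)
    rw [h1, norm_mul, ← hβ] at h2
    exact mul_left_cancel₀ hβ0.ne' h2
  refine ⟨heq b hsup.symm, heq c (hbc.symm.trans hsup.symm), fun j h1 h2 => ?_⟩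
  have h3 : ‖ζ * (α * y j)‖ < 1 := by
    rw [hn, ← hα, hsup]
    exact mul_lt_mul_of_pos_left (hy j h1 h2) hα0
  have h4 := norm_lt_of_norm_sub_lt (hx j) h3
  rw [norm_mul, ← hβ] at h4
  exact lt_of_mul_lt_mul_left h4 hβ0.le

/-- A matrix close to the identity preserves a strictly dominant coordinate and its norm. -/
lemma dominant_mulVec {k : Type*} [NormedField k] [IsUltrametricDist k] {n : ℕ}
    {g : Matrix (Fin n) (Fin n) k} (hg : matSup (g - 1) < 1) {v : Fin n → k} {m : Fin n}
    (hpos : 0 < ‖v m‖) (hv : ∀ j, j ≠ m → ‖v j‖ < ‖v m‖) :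
    ‖g.mulVec v m‖ = ‖v m‖ ∧ ∀ j, j ≠ m → ‖g.mulVec v j‖ < ‖v m‖ := by
  have h1 := norm_mulVec_sub_lt hg hpos (v := v) fun j => by
    rcases eq_or_ne j m with rfl | hj
    · exact le_rfl
    · exact (hv j hj).le
  exact ⟨norm_eq_of_norm_sub_lt (h1 m), fun j hj => norm_lt_of_norm_sub_lt (h1 j) (hv j hj)⟩

/-- Powers of a matrix conjugate, by a matrix close to the identity, to a diagonal matrix whose
entry at `b` is largest and whose entry at `c` is smallest, applied to a vector whose
largest coordinates are at `b` and `c`. -/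
lemma exists_dominant_zpow {k : Type*} [NormedField k] [IsUltrametricDist k] {n : ℕ}
    {g C : (Matrix (Fin n) (Fin n) k)ˣ} {d : Fin n → k} {b c : Fin n} {N : ℝ}
    (hg : matSup ((g : Matrix (Fin n) (Fin n) k) - 1) < 1)
    (hg' : matSup (((g⁻¹ : _) : Matrix (Fin n) (Fin n) k) - 1) < 1)
    (hN : 2 ≤ N) (hd : ∀ i, d i ≠ 0)
    (hC : (C : Matrix (Fin n) (Fin n) k) =
      (g : Matrix (Fin n) (Fin n) k) * Matrix.diagonal d * ((g⁻¹ : _) : Matrix (Fin n) (Fin n) k))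
    (hdb : ‖d b‖ = N) (hdc : ‖d c‖ < N⁻¹) (hdle : ∀ j, ‖d j‖ ≤ N)
    (hdge : ∀ j, j ≠ c → N⁻¹ ≤ ‖d j‖) {u : Fin n → k} (hu0 : u ≠ 0)
    (hub : ‖u b‖ = supN u) (huc : ‖u c‖ = supN u)
    (hu : ∀ j, j ≠ b → j ≠ c → ‖u j‖ < supN u) {p : ℤ} (hp : p ≠ 0) :
    ∃ m, (m = b ∨ m = c) ∧ let z := ((C ^ p : _) : Matrix (Fin n) (Fin n) k).mulVec u
      (2 : ℝ) ^ p.natAbs * supN u ≤ ‖z m‖ ∧ ∀ j, j ≠ m → ‖z j‖ < ‖z m‖ := by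
  have hM := supN_pos hu0
  set v := ((g⁻¹ : _) : Matrix (Fin n) (Fin n) k).mulVec u with hvdef
  have hv := norm_mulVec_sub_lt hg' hM (norm_le_supN u)
  have hvb : ‖v b‖ = supN u := hub ▸ norm_eq_of_norm_sub_lt (hub.symm ▸ hv b)
  have hvc : ‖v c‖ = supN u := huc ▸ norm_eq_of_norm_sub_lt (huc.symm ▸ hv c)
  have hvj : ∀ j, j ≠ b → j ≠ c → ‖v j‖ < supN u := fun j h1 h2 =>
    norm_lt_of_norm_sub_lt (hv j) (hu j h1 h2)
  have hvle : ∀ j, ‖v j‖ ≤ supN u := fun j => by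
    by_cases h1 : j = b
    · rw [h1, hvb]
    by_cases h2 : j = c
    · rw [h2, hvc]
    exact (hvj j h1 h2).le
  set D := g⁻¹ * C * g with hDdef
  have hD : (D : Matrix (Fin n) (Fin n) k) = Matrix.diagonal d := by
    rw [hDdef, Units.val_mul, Units.val_mul, hC]
    simp only [Matrix.mul_assoc, Units.inv_mul, Matrix.mul_one]
    rw [← Matrix.mul_assoc, Units.inv_mul, Matrix.one_mul]
  have hCD : C ^ p = g * D ^ p * g⁻¹ := by
    rw [← conj_zpow, hDdef]
    congr 1
    group
  set x := ((D ^ p : _) : Matrix (Fin n) (Fin n) k).mulVec v with hxdef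
  have hz : ((C ^ p : _) : Matrix (Fin n) (Fin n) k).mulVec u =
      (g : Matrix (Fin n) (Fin n) k).mulVec x := by
    rw [hCD, Units.val_mul, Units.val_mul, hxdef, hvdef, Matrix.mulVec_mulVec,
      Matrix.mulVec_mulVec, Matrix.mul_assoc]
  have hx : ∀ j, ‖x j‖ = ‖d j‖ ^ p * ‖v j‖ := fun j => by
    rw [hxdef, coe_zpow_eq_diagonal D hd hD p, Matrix.mulVec_diagonal, norm_mul, norm_zpow]
  suffices h : ∃ m, (m = b ∨ m = c) ∧ (2 : ℝ) ^ p.natAbs * supN u ≤ ‖x m‖ ∧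
      ∀ j, j ≠ m → ‖x j‖ < ‖x m‖ by
    obtain ⟨m, hm, h1, h2⟩ := h
    have hpos : 0 < ‖x m‖ := lt_of_lt_of_le (by positivity) h1
    obtain ⟨h3, h4⟩ := dominant_mulVec hg hpos h2
    refine ⟨m, hm, ?_⟩
    rw [hz]
    exact ⟨h3.symm ▸ h1, h3.symm ▸ h4⟩
  have hN0 : 0 < N := by linarith
  have hdpos : ∀ j, 0 < ‖d j‖ := fun j => norm_pos_iff.mpr (hd j)
  simp only [hx]
  obtain ⟨q, rfl | rfl⟩ := p.eq_nat_or_neg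
  · have hq : q ≠ 0 := by simpa using hp
    refine ⟨b, Or.inl rfl, ?_, fun j hj => ?_⟩
    · rw [hvb, hdb, zpow_natCast, Int.natAbs_natCast]
      gcongr
    · rw [hvb, hdb, zpow_natCast, zpow_natCast]
      by_cases hjc : j = c
      · rw [hjc, hvc]
        have h1 : ‖d c‖ < N := hdc.trans_le ((inv_le_one_of_one_le₀ (by linarith)).trans
          (by linarith))
        gcongr
      · exact mul_lt_mul' (pow_le_pow_left₀ (norm_nonneg _) (hdle j) q) (hvj j hj hjc)
          (norm_nonneg _) (by positivity)
  · have hq : q ≠ 0 := by simpa using hp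
    have hinv : N < ‖d c‖⁻¹ := (lt_inv_comm₀ hN0 (hdpos c)).mpr hdc
    refine ⟨c, Or.inr rfl, ?_, fun j hj => ?_⟩
    · rw [hvc, zpow_neg, zpow_natCast, ← inv_pow, Int.natAbs_neg, Int.natAbs_natCast]
      have h2 : 2 ≤ ‖d c‖⁻¹ := hN.trans hinv.le
      gcongr
    · rw [hvc, zpow_neg, zpow_natCast, ← inv_pow, zpow_neg, zpow_natCast, ← inv_pow]
      have h1 : ‖d j‖⁻¹ ≤ N := inv_le_of_inv_le₀ hN0 (hdge j hj)
      have h2 : ‖d j‖⁻¹ ^ q < ‖d c‖⁻¹ ^ q :=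
        pow_lt_pow_left₀ (h1.trans_lt hinv) (by positivity) hq
      exact (mul_le_mul_of_nonneg_left (hvle j) (by positivity)).trans_lt
        (mul_lt_mul_of_pos_right h2 hM)

/-- Claim 1 in the proof of Theorem 1: over a nonarchimedean local field,
any matrix `C_ε = h·diag(λ₁,λ₂,λ₃,A')·h⁻¹` in the described neighborhood of
`C = diag(ν, 1+ν, (ν+ν²)⁻¹, A)` satisfies: for all `p ≠ 0` and `[u] ∈ B_ε(y)`,
`dist([C_ε^p u], ℙ(V)) ≥ 1/6` and `‖C_ε^p u‖ ≥ 2^{|p|}·‖u‖`. -/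
theorem stmt7 {k : Type*} [NormedField k] [CompleteSpace k] [LocallyCompactSpace k]
    (hna : IsNonarchimedean fun x : k => ‖x‖) (hnt : ∃ x : k, 1 < ‖x‖)
    (n : ℕ) (hn : 3 ≤ n) (s : ℕ) (ν : Fin s → k)
    (hνdec : ∀ i j : Fin s, i < j → ‖ν j‖ < ‖ν i‖) (hν2 : ∀ i : Fin s, 2 < ‖ν i‖)
    (hcase : n = 2 * s + 4 ∨ n = 2 * s + 5 ∨ (n ≤ 5 ∧ s = 0))
    (ν₀ : k)
    (hν₀ : 10 * (n : ℝ) * (1 + max (supN (Adiag n s ν)) (supN fun j => (Adiag n s ν j)⁻¹))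
      ≤ ‖ν₀‖)
    (ε : ℝ) (hε0 : 0 < ε)
    (hεsep : ∀ i j : Fin n, i ≠ j →
      ε ≤ (1 / 2) * ‖Cdiag n s ν₀ ν i - Cdiag n s ν₀ ν j‖)
    (hεν : ε ≤ ‖ν₀‖⁻¹ ^ 3)
    (y : Fin n → k)
    (hy : y = fun i : Fin n =>
      if (i : ℕ) = 0 then 1 else if (i : ℕ) = 1 then ν₀
      else if (i : ℕ) = 2 then -(1 + ν₀) else 0)
    (V : Submodule k (Fin n → k))
    (hV : V = LinearMap.ker
      ((LinearMap.proj (⟨0, by omega⟩ : Fin n) + LinearMap.proj ⟨1, by omega⟩ +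
        LinearMap.proj ⟨2, by omega⟩ : (Fin n → k) →ₗ[k] k)))
    (h : (Matrix (Fin n) (Fin n) k)ˣ)
    (hh1 : matSup ((h : Matrix (Fin n) (Fin n) k) - 1) < ε)
    (hh2 : matSup (((h⁻¹ : _) : Matrix (Fin n) (Fin n) k) - 1) < ε)
    (l₁ l₂ l₃ : k)
    (hl₁ : ‖l₁ - ν₀‖ < ε) (hl₂ : ‖l₂ - (1 + ν₀)‖ < ε) (hl₃ : ‖l₃ - (ν₀ + ν₀ ^ 2)⁻¹‖ < ε)
    (A' : Fin (n - 3) → k) (hA'0 : ∀ j, A' j ≠ 0)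
    (hA' : ∀ j, ‖Adiag n s ν j - A' j‖ < ε)
    (Cε : (Matrix (Fin n) (Fin n) k)ˣ)
    (hCε : (Cε : Matrix (Fin n) (Fin n) k) =
      (h : Matrix (Fin n) (Fin n) k) * Matrix.diagonal (Ddiag n l₁ l₂ l₃ A') *
        ((h⁻¹ : _) : Matrix (Fin n) (Fin n) k)) :
    ∀ p : ℤ, p ≠ 0 → ∀ u : Fin n → k, u ≠ 0 → dPg y u ≤ ε →
      (1 / 6 : ℝ) ≤ distPSg (((Cε ^ p : _) : Matrix (Fin n) (Fin n) k).mulVec u) V ∧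
      (2 : ℝ) ^ p.natAbs * supN u ≤ supN (((Cε ^ p : _) : Matrix (Fin n) (Fin n) k).mulVec u) := by
  have : IsUltrametricDist k := IsUltrametricDist.isUltrametricDist_of_isNonarchimedean_norm hna
  intro p hp u hu hdist
  have hn3 : (3 : ℝ) ≤ n := by exact_mod_cast hn
  set N := ‖ν₀‖ with hNdef
  set S := max (supN (Adiag n s ν)) (supN fun j => (Adiag n s ν j)⁻¹) with hS
  have hS0 : 0 ≤ S := (supN_nonneg _).trans (le_max_left _ _)
  have hNS : 30 * (1 + S) ≤ N := le_trans (by nlinarith) hν₀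
  have hN : 30 ≤ N := by linarith
  have hN0 : 0 < N := by linarith
  have hε1 : ε < 1 := hεν.trans_lt (pow_lt_one₀ (by positivity)
    (inv_lt_one_of_one_lt₀ (by linarith)) (by norm_num))
  have hN3 : N⁻¹ ^ 3 < N⁻¹ ^ 2 :=
    pow_lt_pow_right_of_lt_one₀ (by positivity) (inv_lt_one_of_one_lt₀ (by linarith)) (by norm_num)
  have hN2 : N⁻¹ ^ 2 < N⁻¹ := by
    simpa using pow_lt_pow_right_of_lt_one₀ (a := N⁻¹) (by positivity)
      (inv_lt_one_of_one_lt₀ (by linarith)) (show 1 < 2 by norm_num)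
  have hν1 : ‖1 + ν₀‖ = N := norm_eq_of_norm_sub_lt (by simpa using by linarith)
  have hl₁' : ‖l₁‖ = N := norm_eq_of_norm_sub_lt (hl₁.trans (by linarith))
  have hl₂' : ‖l₂‖ = N :=
    (norm_eq_of_norm_sub_lt (hl₂.trans (by rw [hν1]; linarith))).trans hν1
  have h3 : ‖(ν₀ + ν₀ ^ 2)⁻¹‖ = N⁻¹ ^ 2 := by
    rw [show ν₀ + ν₀ ^ 2 = ν₀ * (1 + ν₀) by ring, norm_inv, norm_mul, hν1, inv_pow, sq]
  have hl₃' : ‖l₃‖ = N⁻¹ ^ 2 :=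
    (norm_eq_of_norm_sub_lt (hl₃.trans (by rw [h3]; linarith))).trans h3
  have hAle : ∀ j, ‖A' j‖ ≤ N ∧ N⁻¹ ≤ ‖A' j‖ := fun j => by
    have h4 : ‖Adiag n s ν j‖ ≤ S := (norm_le_supN _ j).trans (le_max_left _ _)
    have h5 : ‖(Adiag n s ν j)⁻¹‖ ≤ S :=
      (norm_le_supN (fun j => (Adiag n s ν j)⁻¹) j).trans (le_max_right _ _)
    have h6 : 0 < ‖Adiag n s ν j‖ := norm_pos_iff.mpr (Adiag_ne_zero hν2 j)
    have h7 : N⁻¹ ≤ ‖Adiag n s ν j‖ := by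
      rw [norm_inv] at h5
      exact inv_le_of_inv_le₀ h6 (by linarith)
    have h8 : ‖A' j‖ = ‖Adiag n s ν j‖ := norm_eq_of_norm_sub_lt (by
      rw [norm_sub_rev]
      linarith [hA' j])
    rw [h8]
    exact ⟨by linarith, h7⟩
  let a : Fin n := ⟨0, by omega⟩
  let b : Fin n := ⟨1, by omega⟩
  let c : Fin n := ⟨2, by omega⟩
  have hab : a ≠ b := by simp [a, b]
  have hac : a ≠ c := by simp [a, c]
  have hbc : b ≠ c := by simp [b, c]
  set d := Ddiag n l₁ l₂ l₃ A' with hd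
  have hdb : ‖d b‖ = N := by simpa [hd, Ddiag, b] using hl₂'
  have hdc : ‖d c‖ = N⁻¹ ^ 2 := by simpa [hd, Ddiag, c] using hl₃'
  have hdj : ∀ j, j ≠ c → ‖d j‖ ≤ N ∧ N⁻¹ ≤ ‖d j‖ := fun j hj => by
    have hNN : N⁻¹ ≤ N := (inv_le_one_of_one_le₀ (by linarith)).trans (by linarith)
    have hj2 : (j : ℕ) ≠ 2 := fun h => hj (Fin.ext h)
    by_cases h0 : (j : ℕ) = 0
    · simpa [hd, Ddiag, h0, hl₁'] using hNN
    by_cases h1 : (j : ℕ) = 1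
    · simpa [hd, Ddiag, h1, hl₂'] using hNN
    have hj3 : 3 ≤ (j : ℕ) := by omega
    simpa [hd, Ddiag, h0, h1, hj2, hj3] using hAle ⟨(j : ℕ) - 3, by omega⟩
  have hdle : ∀ j, ‖d j‖ ≤ N := fun j => by
    rcases eq_or_ne j c with rfl | hj
    · rw [hdc]
      exact hN2.le.trans ((inv_le_one_of_one_le₀ (by linarith)).trans (by linarith))
    · exact (hdj j hj).1
  have hd0 : ∀ j, d j ≠ 0 := fun j => by
    rw [← norm_pos_iff]
    rcases eq_or_ne j c with rfl | hj
    · rw [hdc]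
      positivity
    · exact lt_of_lt_of_le (by positivity) (hdj j hj).2
  have hyb : ‖y b‖ = N := by simp [hy, b, hNdef]
  have hyc : ‖y c‖ = N := by
    rw [← hν1, ← norm_neg]
    simp [hy, c]
  have hyj : ∀ j, j ≠ b → j ≠ c → ‖y j‖ < ‖y b‖ := fun j h1 h2 => by
    have h1' : (j : ℕ) ≠ 1 := fun h => h1 (Fin.ext h)
    have h2' : (j : ℕ) ≠ 2 := fun h => h2 (Fin.ext h)
    rw [hyb]
    simp only [hy, h1', h2', if_false]
    split_ifs
    · rw [norm_one]
      linarith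
    · rwa [norm_zero]
  have hy0 : y ≠ 0 := fun h => by
    rw [h, Pi.zero_apply, norm_zero] at hyb
    linarith
  obtain ⟨hub, huc, huj⟩ :=
    norm_eq_supN_of_dPg_lt_one hy0 (hyb.trans hyc.symm) hyj hu (hdist.trans_lt hε1)
  obtain ⟨m, hm, hgrow, hdom⟩ := exists_dominant_zpow (hh1.trans hε1) (hh2.trans hε1)
    (by linarith : 2 ≤ N) hd0 hCε hdb (by rwa [hdc]) hdle (fun j hj => (hdj j hj).2)
    hu hub huc huj hp
  have hmem : ∀ w, w ∈ V ↔ w a + w b + w c = 0 := fun w => by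
    simp [hV, a, b, c]
  have hV0 : ∃ w ∈ V, w ≠ 0 := by
    refine ⟨Pi.single a 1 - Pi.single b 1, ?_, fun h => ?_⟩
    · rw [hmem]
      simp [hab, hab.symm, hac.symm, hbc.symm]
    · simpa [hab] using congrFun h a
  have hpos := supN_pos hu
  obtain ⟨h1, h2⟩ := one_le_distPSg_of_dominant hab hac hbc (fun w => (hmem w).mp) hV0 hm
    (lt_of_lt_of_le (by positivity) hgrow) hdom
  exact ⟨le_trans (by norm_num) h1, h2.symm ▸ hgrow⟩
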